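/- Let G be a finite simple graph with ν_G vertices and ε_G edges, and define f_G(u) = det[ I − u·𝓐(G) + u²·(𝓓(G) − I) ]. Then f_G'(1) = 2(ε_G − ν_G) κ(G). -/

import Mathlib

open scoped Classical
noncomputable section

/-- The finset of spanning trees of a finite simple graph `G`. -/
def spanningTrees {V : Type*} [Fintype V] [DecidableEq V] (G : SimpleGraph V) :
    Finset (SimpleGraph V) :=
  Finset.univ.filter fun T => T ≤ G ∧ T.IsTree

/-- The graph joining each vertex `v` to its image `f v`. -/
def parentGraph {V : Type*} (f : V → V) : SimpleGraph V :=
  SimpleGraph.fromRel fun v w => f v = w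

section ParentGraph

variable {V : Type*} {f g : V → V} {r : V} {d : V → ℕ}

theorem parentGraph_adj_apply {v : V} (h : f v ≠ v) : (parentGraph f).Adj v (f v) := by
  simp [parentGraph, h.symm]

theorem parentGraph_le {G : SimpleGraph V} (hr : f r = r) (hf : ∀ v, v ≠ r → G.Adj v (f v)) :
    parentGraph f ≤ G := by
  intro v w h
  simp only [parentGraph, SimpleGraph.fromRel_adj] at h
  obtain ⟨hne, rfl | rfl⟩ := h
  · exact hf v (by rintro rfl; exact hne hr.symm)
  · exact (hf w (by rintro rfl; exact hne hr)).symm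

/-- If every vertex reaches `r` under iteration of `f`, the number of iterations needed is a depth
function. -/
theorem exists_depth (h : ∀ v, ∃ k, f^[k] v = r) :
    ∃ d : V → ℕ, d r = 0 ∧ ∀ v, v ≠ r → d v = d (f v) + 1 := by
  exact ⟨fun v => Nat.find (h v), by simp, fun v hv =>
    Nat.find_comp_succ (h v) (h (f v)) (by simpa using hv)⟩

theorem exists_iterate_eq_of_depth (hd : ∀ v, v ≠ r → d v = d (f v) + 1) (v : V) :
    ∃ k, f^[k] v = r := by
  induction hn : d v generalizing v with
  | zero =>
    by_contra! h
    have := hd v (h 0)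
    omega
  | succ n ih =>
    by_cases hv : v = r
    · exact ⟨0, hv⟩
    · obtain ⟨k, hk⟩ := ih (f v) (by have := hd v hv; omega)
      exact ⟨k + 1, hk⟩

theorem exists_walk_length_eq_depth (h0 : d r = 0) (hd : ∀ v, v ≠ r → d v = d (f v) + 1) (v : V) :
    ∃ p : (parentGraph f).Walk v r, p.length = d v := by
  induction hn : d v generalizing v with
  | zero =>
    have hv : v = r := by
      by_contra h
      have := hd v h
      omega
    subst hv
    exact ⟨.nil, rfl⟩
  | succ n ih =>
    have hv : v ≠ r := by rintro rfl; omega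
    have hdv := hd v hv
    obtain ⟨p, hp⟩ := ih (f v) (by omega)
    refine ⟨.cons (parentGraph_adj_apply fun h => ?_) p, by simp [hp]⟩
    rw [h] at hdv
    omega

theorem depth_le_length (h0 : d r = 0) (hr : f r = r) (hd : ∀ v, v ≠ r → d v = d (f v) + 1)
    {v : V} (p : (parentGraph f).Walk v r) : d v ≤ p.length := by
  induction p with
  | nil => simp [h0]
  | @cons u v w h p ih =>
    have ih := ih h0 hr hd
    rw [SimpleGraph.Walk.length_cons]
    simp only [parentGraph, SimpleGraph.fromRel_adj] at h
    obtain ⟨hne, rfl | rfl⟩ := h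
    · by_cases hu : u = w
      · subst hu
        omega
      · have := hd u hu
        omega
    · by_cases hv : v = w
      · subst hv
        exact absurd hr hne
      · have := hd v hv
        omega

theorem dist_parentGraph (h0 : d r = 0) (hr : f r = r) (hd : ∀ v, v ≠ r → d v = d (f v) + 1)
    (v : V) : (parentGraph f).dist v r = d v := by
  obtain ⟨p, hp⟩ := exists_walk_length_eq_depth h0 hd v
  obtain ⟨q, hq⟩ := p.reachable.exists_walk_length_eq_dist
  have := SimpleGraph.dist_le p
  have := depth_le_length h0 hr hd q
  omega

theorem connected_parentGraph (h0 : d r = 0) (hd : ∀ v, v ≠ r → d v = d (f v) + 1) :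
    (parentGraph f).Connected := by
  have := Nonempty.intro r
  refine ⟨fun v w => ?_⟩
  obtain ⟨p, -⟩ := exists_walk_length_eq_depth h0 hd v
  obtain ⟨q, -⟩ := exists_walk_length_eq_depth h0 hd w
  exact p.reachable.trans q.reachable.symm

theorem isTree_parentGraph [Finite V] (h0 : d r = 0) (hr : f r = r)
    (hd : ∀ v, v ≠ r → d v = d (f v) + 1) : (parentGraph f).IsTree := by
  have hc := connected_parentGraph h0 hd
  refine SimpleGraph.isTree_iff_connected_and_card.2
    ⟨hc, le_antisymm ?_ hc.card_vert_le_card_edgeSet_add_one⟩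
  have := Fintype.ofFinite V
  have hsub : (parentGraph f).edgeSet ⊆ (fun v => s(v, f v)) '' {v | v ≠ r} := by
    intro e
    induction e with
    | _ v w =>
      intro h
      simp only [SimpleGraph.mem_edgeSet, parentGraph, SimpleGraph.fromRel_adj] at h
      obtain ⟨hne, rfl | rfl⟩ := h
      · exact ⟨v, by rintro rfl; exact hne hr.symm, rfl⟩
      · exact ⟨w, by rintro rfl; exact hne hr, Sym2.eq_swap⟩
  have h1 := (Set.ncard_le_ncard hsub (Set.toFinite _)).trans (Set.ncard_image_le (Set.toFinite _))
  have h2 : ({v | v ≠ r} : Set V).ncard + 1 = Nat.card V := by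
    have := Set.ncard_add_ncard_compl ({r} : Set V)
    rw [Set.ncard_singleton] at this
    rw [← this, add_comm]
    rfl
  rw [Nat.card_coe_set_eq]
  omega

theorem parentGraph_injective (hfr : f r = r) (hgr : g r = r) (hf : ∀ v, ∃ k, f^[k] v = r)
    (hg : ∀ v, ∃ k, g^[k] v = r) (h : parentGraph f = parentGraph g) : f = g := by
  obtain ⟨d, d0, hd⟩ := exists_depth hf
  obtain ⟨e, e0, he⟩ := exists_depth hg
  have hde : ∀ v, d v = e v := fun v => by
    rw [← dist_parentGraph d0 hfr hd, ← dist_parentGraph e0 hgr he, h]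
  funext v
  by_cases hv : v = r
  · rw [hv, hfr, hgr]
  · have hdv := hd v hv
    have hadj : (parentGraph f).Adj v (f v) := parentGraph_adj_apply fun h' => by
      rw [h'] at hdv
      omega
    rw [h] at hadj
    simp only [parentGraph, SimpleGraph.fromRel_adj] at hadj
    obtain ⟨-, h' | h'⟩ := hadj
    · exact h'.symm
    · exfalso
      by_cases hfv : f v = r
      · rw [hfv, hgr] at h'
        exact hv h'.symm
      · have := he _ hfv
        rw [h', ← hde, ← hde] at this
        omega

theorem exists_parentGraph_eq {T : SimpleGraph V} (hT : T.IsTree) (r : V) :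
    ∃ f : V → V, f r = r ∧ (∀ v, v ≠ r → T.Adj v (f v)) ∧ (∀ v, ∃ k, f^[k] v = r) ∧
      parentGraph f = T := by
  have hstep : ∀ v, ∃ w, (v = r → w = r) ∧ (v ≠ r → T.Adj v w ∧ T.dist v r = T.dist w r + 1) := by
    intro v
    by_cases hv : v = r
    · exact ⟨r, fun _ => rfl, fun h => absurd hv h⟩
    · obtain ⟨p, hp⟩ := hT.connected.exists_walk_length_eq_dist v r
      cases p with
      | nil => exact absurd rfl hv
      | @cons _ w _ hadj p =>
        refine ⟨w, fun h => absurd h hv, fun _ => ⟨hadj, ?_⟩⟩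
        have h1 := SimpleGraph.dist_le p
        obtain ⟨q, hq⟩ := hT.connected.exists_walk_length_eq_dist w r
        have h2 := SimpleGraph.dist_le (SimpleGraph.Walk.cons hadj q)
        simp only [SimpleGraph.Walk.length_cons] at hp h2
        omega
  choose f hfr hf using hstep
  have hle : parentGraph f ≤ T := parentGraph_le (hfr r rfl) fun v hv => (hf v hv).1
  refine ⟨f, hfr r rfl, fun v hv => (hf v hv).1,
    exists_iterate_eq_of_depth (d := (T.dist · r)) fun v hv => (hf v hv).2, ?_⟩
  exact le_antisymm hle ((SimpleGraph.isTree_iff_minimal_connected.1 hT).2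
    (connected_parentGraph (d := (T.dist · r)) (by simp) fun v hv => (hf v hv).2) hle)

end ParentGraph

section Determinant

open Matrix

variable {V : Type*} [Fintype V] [DecidableEq V]

theorem det_parent_matrix (f : V → V) (r : V) (hr : f r = r) :
    (of fun v => Pi.single v (1 : ℝ) - if v = r then 0 else Pi.single (f v) 1 :
      Matrix V V ℝ).det = if ∀ v, ∃ k, f^[k] v = r then 1 else 0 := by
  split_ifs with h
  · obtain ⟨d, -, hd⟩ := exists_depth h
    have htri : (of fun v => Pi.single v (1 : ℝ) - if v = r then 0 else Pi.single (f v) 1 :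
        Matrix V V ℝ).BlockTriangular (OrderDual.toDual ∘ d) := by
      intro v w hvw
      have hlt : d v < d w := hvw
      have hne : w ≠ v := by rintro rfl; omega
      by_cases hv : v = r
      · simp [hv, hv ▸ hne]
      · have hne' : w ≠ f v := by
          rintro rfl
          have := hd v hv
          omega
        simp [hv, hne, hne']
    rw [htri.det]
    refine Finset.prod_eq_one fun a _ => ?_
    refine Eq.trans (congrArg det ?_) det_one
    ext ⟨v, hv⟩ ⟨w, hw⟩
    have hvw : d v = d w := OrderDual.toDual.injective (hv.trans hw.symm)
    by_cases hvr : v = r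
    · simp [toSquareBlock, toSquareBlockProp, hvr, one_apply, Pi.single_apply, eq_comm]
    · have hne : w ≠ f v := by
        rintro rfl
        have := hd v hvr
        omega
      simp [toSquareBlock, toSquareBlockProp, hvr, one_apply, Pi.single_apply, hne, eq_comm (a := v)]
  · obtain ⟨v₀, hv₀⟩ := not_forall.1 h
    refine exists_mulVec_eq_zero_iff.1
      ⟨fun v => if ∃ k, f^[k] v = r then 0 else 1, fun h0 => ?_, ?_⟩
    · simpa [hv₀] using congrFun h0 v₀
    · funext v
      have hiff : (∃ k, f^[k] (f v) = r) ↔ ∃ k, f^[k] v = r := by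
        refine ⟨fun ⟨k, hk⟩ => ⟨k + 1, hk⟩, fun ⟨k, hk⟩ => ⟨k, ?_⟩⟩
        rw [← Function.iterate_succ_apply, Function.iterate_succ_apply', hk, hr]
      have hr' : ∃ k, f^[k] r = r := ⟨0, rfl⟩
      by_cases hv : v = r
      · subst hv
        simp [mulVec, hr']
      · change (Pi.single v (1 : ℝ) - if v = r then 0 else Pi.single (f v) 1 : V → ℝ) ⬝ᵥ _ = 0
        rw [if_neg hv, sub_dotProduct, single_dotProduct, single_dotProduct]
        simp [hiff]

/-- The matrix-tree theorem: replacing row `r` of the Laplacian by the `r`-th unit vector gives a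
matrix whose determinant is the number of spanning trees. -/
theorem det_updateRow_lapMatrix_self (G : SimpleGraph V) [DecidableRel G.Adj] (r : V) :
    ((G.lapMatrix ℝ).updateRow r (Pi.single r 1)).det = (spanningTrees G).card := by
  let A : V → Finset V := fun v => if v = r then {r} else G.neighborFinset v
  let g : V → V → V → ℝ := fun v w => Pi.single v 1 - if v = r then 0 else Pi.single w 1
  have hM : (G.lapMatrix ℝ).updateRow r (Pi.single r 1) = fun v => ∑ w ∈ A v, g v w := by
    funext v
    by_cases hv : v = r
    · subst hv
      simp [A, g]
    · funext w
      simp [A, g, hv, SimpleGraph.lapMatrix, SimpleGraph.degMatrix, diagonal_apply,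
        Pi.single_apply, eq_comm (a := v)]
  have hsum := (detRowAlternating (R := ℝ) (n := V)).toMultilinearMap.map_sum_finset g A
  have hA : ∀ {f : V → V}, f ∈ Fintype.piFinset A ↔ f r = r ∧ ∀ v, v ≠ r → G.Adj v (f v) := by
    intro f
    rw [Fintype.mem_piFinset]
    refine ⟨fun h => ⟨by simpa [A] using h r, fun v hv => by simpa [A, hv] using h v⟩, ?_⟩
    rintro ⟨h0, h⟩ v
    by_cases hv : v = r
    · simp [A, hv, h0]
    · simpa [A, hv] using h v hv
  rw [hM]
  refine hsum.trans ?_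
  refine (Finset.sum_congr rfl fun f hf => det_parent_matrix f r (hA.1 hf).1).trans ?_
  rw [Finset.sum_boole]
  congr 1
  refine Finset.card_bij (fun f _ => parentGraph f) ?_ ?_ ?_
  · intro f hf
    obtain ⟨hf, hreach⟩ := Finset.mem_filter.1 hf
    obtain ⟨d, d0, hd⟩ := exists_depth hreach
    simp only [spanningTrees, Finset.mem_filter, Finset.mem_univ, true_and]
    exact ⟨parentGraph_le (hA.1 hf).1 (hA.1 hf).2, isTree_parentGraph d0 (hA.1 hf).1 hd⟩
  · intro f hf f' hf' h
    obtain ⟨hf, hreach⟩ := Finset.mem_filter.1 hf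
    obtain ⟨hf', hreach'⟩ := Finset.mem_filter.1 hf'
    exact parentGraph_injective (hA.1 hf).1 (hA.1 hf').1 hreach hreach' h
  · intro T hT
    simp only [spanningTrees, Finset.mem_filter, Finset.mem_univ, true_and] at hT
    obtain ⟨f, hr, hf, hreach, h⟩ := exists_parentGraph_eq hT.2 r
    exact ⟨f, Finset.mem_filter.2 ⟨hA.2 ⟨hr, fun v hv => hT.1 (hf v hv)⟩, hreach⟩, h⟩

theorem det_updateRow_lapMatrix_single (G : SimpleGraph V) [DecidableRel G.Adj] (v w : V) :
    ((G.lapMatrix ℝ).updateRow v (Pi.single w 1)).det = (spanningTrees G).card := by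
  have hzero : ((G.lapMatrix ℝ).updateRow v (Pi.single w 1 - Pi.single v 1)).det = 0 := by
    refine exists_mulVec_eq_zero_iff.1 ⟨fun _ => 1, fun h => one_ne_zero (congrFun h v), ?_⟩
    funext i
    by_cases hi : i = v
    · subst hi
      simp [mulVec, dotProduct]
    · have := congrFun (G.lapMatrix_mulVec_const_eq_zero (R := ℝ)) i
      simpa [mulVec, updateRow_ne hi] using this
  have hadd := det_updateRow_add (G.lapMatrix ℝ) v (Pi.single w 1 - Pi.single v 1) (Pi.single v 1)
  rwa [sub_add_cancel, hzero, zero_add, det_updateRow_lapMatrix_self] at hadd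

theorem det_updateRow_lapMatrix (G : SimpleGraph V) [DecidableRel G.Adj] (v : V) (x : V → ℝ) :
    ((G.lapMatrix ℝ).updateRow v x).det = (∑ w, x w) * (spanningTrees G).card := by
  have h := map_sum (cramer (G.lapMatrix ℝ)ᵀ) (fun w => x w • Pi.single w (1 : ℝ)) Finset.univ
  have hx : ∑ w, x w • Pi.single w (1 : ℝ) = x := by
    funext i
    simp [Finset.sum_apply, Pi.single_apply]
  rw [hx] at h
  rw [← cramer_transpose_apply, h, Finset.sum_apply, Finset.sum_mul]
  refine Finset.sum_congr rfl fun w _ => ?_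
  rw [map_smul, Pi.smul_apply, cramer_transpose_apply, det_updateRow_lapMatrix_single, smul_eq_mul]

/-- Jacobi's formula, with the derivative written as a sum over rows. -/
theorem HasDerivAt.matrix_det {M : ℝ → Matrix V V ℝ} {M' : Matrix V V ℝ} {t : ℝ}
    (h : ∀ i j, HasDerivAt (fun u => M u i j) (M' i j) t) :
    HasDerivAt (fun u => (M u).det) (∑ i, ((M t).updateRow i (M' i)).det) t := by
  let D : ContinuousMultilinearMap ℝ (fun _ : V => V → ℝ) ℝ :=
    { toMultilinearMap := (detRowAlternating (R := ℝ) (n := V)).toMultilinearMap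
      cont := Continuous.matrix_det (A := fun B : V → V → ℝ => of B) continuous_id }
  have hM : HasDerivAt (fun u => (M u : V → V → ℝ)) M' t :=
    hasDerivAt_pi.2 fun i => hasDerivAt_pi.2 fun j => h i j
  have hD := (D.hasFDerivAt (M t)).comp_hasDerivAt t hM
  exact hD.congr_deriv (D.linearDeriv_apply (M t) M')

end Determinant

/-- Corollary (Northshield): for a finite simple graph `G` with `ν_G` vertices and `ε_G`
edges, the function `f_G(u) = det(I - u·𝓐(G) + u²·(𝓓(G) - I))` satisfies
`f_G'(1) = 2(ε_G - ν_G)·κ(G)`, where `κ(G)` is the number of spanning trees of `G`. -/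
theorem deriv_zeta_variation_eq {V : Type*} [Fintype V] [DecidableEq V]
    (G : SimpleGraph V) [DecidableRel G.Adj] :
    HasDerivAt
      (fun u : ℝ =>
        ((1 : Matrix V V ℝ) - u • G.adjMatrix ℝ +
          u ^ 2 • (Matrix.diagonal (fun i => (G.degree i : ℝ)) - 1)).det)
      (2 * ((G.edgeFinset.card : ℝ) - (Fintype.card V : ℝ)) * ((spanningTrees G).card : ℝ))
      1 := by
  have hL : (1 : Matrix V V ℝ) - (1 : ℝ) • G.adjMatrix ℝ +
      (1 : ℝ) ^ 2 • (Matrix.diagonal (fun i => (G.degree i : ℝ)) - 1) = G.lapMatrix ℝ := by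
    rw [SimpleGraph.lapMatrix, SimpleGraph.degMatrix, one_smul, one_pow, one_smul]
    abel
  have hderiv := HasDerivAt.matrix_det (t := 1)
    (M := fun u : ℝ => (1 : Matrix V V ℝ) - u • G.adjMatrix ℝ +
      u ^ 2 • (Matrix.diagonal (fun i => (G.degree i : ℝ)) - 1))
    (M' := (2 : ℝ) • (Matrix.diagonal (fun i => (G.degree i : ℝ)) - 1) - G.adjMatrix ℝ)
    (fun i j => by
      have h1 := (hasDerivAt_id (1 : ℝ)).mul_const (G.adjMatrix ℝ i j)
      have h2 := (hasDerivAt_pow 2 (1 : ℝ)).mul_const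
        ((Matrix.diagonal (fun i => (G.degree i : ℝ)) - 1 : Matrix V V ℝ) i j)
      convert! (h1.const_sub ((1 : Matrix V V ℝ) i j)).add h2 using 1
      simp
      ring)
  convert! hderiv using 1
  simp only [hL, det_updateRow_lapMatrix]
  rw [← Finset.sum_mul]
  congr 1
  have hrow : ∀ i, ∑ j, ((2 : ℝ) • (Matrix.diagonal (fun i => (G.degree i : ℝ)) - 1) -
      G.adjMatrix ℝ : Matrix V V ℝ) i j = G.degree i - 2 := by
    intro i
    simp [Matrix.diagonal_apply, Matrix.one_apply, mul_sub, SimpleGraph.adjMatrix_apply,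
      Finset.sum_sub_distrib, SimpleGraph.degree_eq_sum_if_adj]
    ring
  have hdeg := congrArg (Nat.cast (R := ℝ)) G.sum_degrees_eq_twice_card_edges
  push_cast at hdeg
  simp only [hrow, Finset.sum_sub_distrib, hdeg]
  simp
  ring
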